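/- arXiv:1812.04827 — 2 statements merged into one kernel-verified Lean document; each statement's English description precedes it below -/
import Mathlib

section
/- Let X and Y be two continuously distributed and integrable random variables on an atomless probability space (Ω, F, ℙ), and let p ∈ (0,1). If X and Y are weakly comonotonic with respect to P^X_p, and X and Y are weakly antimonotonic with respect to Q^X_p, then (X, Y) maximizes the VaR_p aggregation, i.e., VaR_p(X+Y) = max{VaR_p(X'+Y') : X' equal in distribution to X, Y' equal in distribution to Y}. -/
open MeasureTheory Set

/-- Value-at-Risk at level `p`: `VaR_p(X) = inf {x ∈ ℝ : ℙ(X ≤ x) > p}`. -/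
noncomputable def VaR {Ω : Type*} [MeasurableSpace Ω] (μ : Measure Ω) (X : Ω → ℝ) (p : ℝ) : ℝ :=
  sInf {x : ℝ | p < (μ {ω | X ω ≤ x}).toReal}

/-- The upper-tail event `A^X_p = {ω ∈ Ω : X ω > VaR_p(X)}`. -/
def tailSet {Ω : Type*} [MeasurableSpace Ω] (μ : Measure Ω) (X : Ω → ℝ) (p : ℝ) : Set Ω :=
  {ω | VaR μ X p < X ω}

/-- `X` is continuously distributed under `μ`. -/
def ContinuouslyDistributed {Ω : Type*} [MeasurableSpace Ω] (μ : Measure Ω) (X : Ω → ℝ) : Prop :=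
  ∀ x : ℝ, μ {ω | X ω = x} = 0

/-- `μ` is an atomless measure: every non-null measurable set has a measurable subset of
strictly smaller positive measure. -/
def Atomless {Ω : Type*} [MeasurableSpace Ω] (μ : Measure Ω) : Prop :=
  ∀ s : Set Ω, MeasurableSet s → 0 < μ s →
    ∃ t ⊆ s, MeasurableSet t ∧ 0 < μ t ∧ μ t < μ s

/-- `X` and `Y` are weakly comonotonic with respect to the product measure `π₁ × π₂`:
`∬ (X ω − X ω')(Y ω − Y ω') π₁(dω) π₂(dω') ≥ 0`. -/
def WeaklyComonotonic {Ω : Type*} [MeasurableSpace Ω] (X Y : Ω → ℝ)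
    (π₁ π₂ : Measure Ω) : Prop :=
  0 ≤ ∫ q : Ω × Ω, (X q.1 - X q.2) * (Y q.1 - Y q.2) ∂(π₁.prod π₂)

/-- `X` and `Y` are weakly antimonotonic with respect to the product measure `π₁ × π₂`:
`∬ (X ω − X ω')(Y ω − Y ω') π₁(dω) π₂(dω') ≤ 0`. -/
def WeaklyAntimonotonic {Ω : Type*} [MeasurableSpace Ω] (X Y : Ω → ℝ)
    (π₁ π₂ : Measure Ω) : Prop :=
  ∫ q : Ω × Ω, (X q.1 - X q.2) * (Y q.1 - Y q.2) ∂(π₁.prod π₂) ≤ 0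

open ProbabilityTheory

section VaR

variable {Ω : Type*} [MeasurableSpace Ω] {μ : Measure Ω} {X Z : Ω → ℝ} {p : ℝ}

lemma measurableSet_tailSet (hZ : Measurable Z) : MeasurableSet (tailSet μ Z p) :=
  measurableSet_lt measurable_const hZ

lemma compl_tailSet : (tailSet μ Z p)ᶜ = {ω | Z ω ≤ VaR μ Z p} := by
  ext ω
  simp [tailSet]

lemma measureReal_gt_eq_of_map_eq {X' : Ω → ℝ} (hX : Measurable X) (hX' : Measurable X')
    (h : μ.map X' = μ.map X) (a : ℝ) : μ.real {ω | a < X' ω} = μ.real {ω | a < X ω} := by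
  have := congrArg (fun ν => ν.real (Ioi a)) h
  simp only [map_measureReal_apply hX measurableSet_Ioi,
    map_measureReal_apply hX' measurableSet_Ioi] at this
  exact this

variable [IsProbabilityMeasure μ]

lemma measureReal_le_eq_cdf (hZ : Measurable Z) (x : ℝ) :
    μ.real {ω | Z ω ≤ x} = cdf (μ.map Z) x := by
  have := Measure.isProbabilityMeasure_map (μ := μ) hZ.aemeasurable
  rw [cdf_eq_real, map_measureReal_apply hZ measurableSet_Iic]
  rfl

lemma VaR_eq_sInf_cdf (hZ : Measurable Z) :
    VaR μ Z p = sInf {x : ℝ | p < cdf (μ.map Z) x} := by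
  simp only [← measureReal_le_eq_cdf hZ]
  rfl

lemma nonempty_lt_cdf (ν : Measure ℝ) (hp : p < 1) : {x : ℝ | p < cdf ν x}.Nonempty :=
  ((tendsto_cdf_atTop ν).eventually_const_lt hp).exists

lemma bddBelow_lt_cdf (ν : Measure ℝ) (hp : 0 < p) : BddBelow {x : ℝ | p < cdf ν x} := by
  obtain ⟨a, ha⟩ := ((tendsto_cdf_atBot ν).eventually_lt_const hp).exists
  exact ⟨a, fun x hx => le_of_not_gt fun h => (ha.trans hx).not_ge (monotone_cdf ν h.le)⟩

lemma VaR_le_of_lt_measureReal (hZ : Measurable Z) (hp : 0 < p) {x : ℝ}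
    (hx : p < μ.real {ω | Z ω ≤ x}) : VaR μ Z p ≤ x := by
  rw [VaR_eq_sInf_cdf hZ]
  exact csInf_le (bddBelow_lt_cdf _ hp) (by simpa [← measureReal_le_eq_cdf hZ] using hx)

lemma le_VaR_of_forall (hZ : Measurable Z) (hp : p < 1) {v : ℝ}
    (h : ∀ x, p < μ.real {ω | Z ω ≤ x} → v ≤ x) : v ≤ VaR μ Z p := by
  rw [VaR_eq_sInf_cdf hZ]
  exact le_csInf (nonempty_lt_cdf _ hp) fun x hx =>
    h x (by simpa [measureReal_le_eq_cdf hZ] using hx)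

lemma le_measureReal_le_VaR (hZ : Measurable Z) (hp : p < 1) :
    p ≤ μ.real {ω | Z ω ≤ VaR μ Z p} := by
  rw [measureReal_le_eq_cdf hZ]
  have hc := ((cdf (μ.map Z)).right_continuous (VaR μ Z p)).tendsto.mono_left
    (nhdsWithin_mono _ Ioi_subset_Ici_self)
  refine ge_of_tendsto hc ?_
  filter_upwards [self_mem_nhdsWithin] with x hx
  rw [mem_Ioi, VaR_eq_sInf_cdf hZ] at hx
  obtain ⟨y, hy, hyx⟩ := exists_lt_of_csInf_lt (nonempty_lt_cdf _ hp) hx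
  exact (lt_of_lt_of_le hy (monotone_cdf _ hyx.le)).le

lemma measureReal_le_VaR_le (hZ : Measurable Z) (hZc : ContinuouslyDistributed μ Z)
    (hp : 0 < p) : μ.real {ω | Z ω ≤ VaR μ Z p} ≤ p := by
  have := Measure.isProbabilityMeasure_map (μ := μ) hZ.aemeasurable
  set v := VaR μ Z p with hv
  have h0 : (cdf (μ.map Z)).measure {v} = 0 := by
    rw [measure_cdf, Measure.map_apply hZ (measurableSet_singleton v)]
    exact hZc v
  rw [StieltjesFunction.measure_singleton, ENNReal.ofReal_eq_zero, sub_nonpos] at h0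
  rw [measureReal_le_eq_cdf hZ]
  refine h0.trans (le_of_tendsto ((monotone_cdf (μ.map Z)).tendsto_leftLim v) ?_)
  filter_upwards [self_mem_nhdsWithin] with x hx
  refine le_of_not_gt fun h => (mem_Iio.1 hx).not_ge (VaR_le_of_lt_measureReal hZ hp ?_)
  rwa [measureReal_le_eq_cdf hZ]

end VaR

section WeakMonotonicity

variable {Ω : Type*} [MeasurableSpace Ω] {X Y : Ω → ℝ}

lemma integral_dirac_prod_dirac (hX : Measurable X) (hY : Measurable Y) (ω ω' : Ω) :
    ∫ q : Ω × Ω, (X q.1 - X q.2) * (Y q.1 - Y q.2)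
      ∂((Measure.dirac ω).prod (Measure.dirac ω')) = (X ω - X ω') * (Y ω - Y ω') := by
  rw [Measure.dirac_prod_dirac, integral_dirac']
  exact Measurable.stronglyMeasurable (by fun_prop)

lemma weaklyComonotonic_dirac_iff (hX : Measurable X) (hY : Measurable Y) (ω ω' : Ω) :
    WeaklyComonotonic X Y (Measure.dirac ω) (Measure.dirac ω') ↔
      0 ≤ (X ω - X ω') * (Y ω - Y ω') := by
  rw [WeaklyComonotonic, integral_dirac_prod_dirac hX hY]

lemma weaklyAntimonotonic_dirac_iff (hX : Measurable X) (hY : Measurable Y) (ω ω' : Ω) :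
    WeaklyAntimonotonic X Y (Measure.dirac ω) (Measure.dirac ω') ↔
      (X ω - X ω') * (Y ω - Y ω') ≤ 0 := by
  rw [WeaklyAntimonotonic, integral_dirac_prod_dirac hX hY]

end WeakMonotonicity

/-- If `A` has positive measure below the level `s` of `X + Y`, then so does `A` on some quadrant
`{X ≤ a, Y ≤ b}` with `a + b < s`. -/
lemma exists_quadrant_measure_pos {Ω : Type*} [MeasurableSpace Ω] {μ : Measure Ω}
    {X Y : Ω → ℝ} {A : Set Ω} {s : ℝ} (h : μ (A ∩ {ω | X ω + Y ω < s}) ≠ 0) :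
    ∃ a b : ℝ, a + b < s ∧ μ (A ∩ {ω | X ω ≤ a ∧ Y ω ≤ b}) ≠ 0 := by
  by_contra! hcon
  refine h (measure_mono_null
    (t := ⋃ q : {q : ℚ × ℚ // (q.1 + q.2 : ℝ) < s}, A ∩ {ω | X ω ≤ q.1.1 ∧ Y ω ≤ q.1.2}) ?_
    (measure_iUnion_null fun q => hcon _ _ q.2))
  rintro ω ⟨hA, hs⟩
  rw [mem_ofPred_eq] at hs
  obtain ⟨a, ha, ha'⟩ := exists_rat_btwn (show X ω < s - Y ω by linarith)
  obtain ⟨b, hb, hb'⟩ := exists_rat_btwn (show Y ω < s - a by linarith)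
  exact mem_iUnion.2 ⟨⟨(a, b), by simp only; linarith⟩, hA, ha.le, hb.le⟩

/-- The tails `{a < X}` and `{b < Y}` of a pair that is antimonotonic on `A` and dominates there its
values outside `A` leave the quadrant `{X ≤ a, Y ≤ b}` of `A` uncovered. -/
lemma measureReal_tails_add_quadrant_le {Ω : Type*} [MeasurableSpace Ω] {μ : Measure Ω}
    [IsFiniteMeasure μ] {X Y : Ω → ℝ} (hX : Measurable X) (hY : Measurable Y) {A : Set Ω}
    (hA : MeasurableSet A) (hXA : ∀ ω ∈ A, ∀ ω' ∉ A, X ω' ≤ X ω)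
    (hYA : ∀ ω ∈ A, ∀ ω' ∉ A, Y ω' ≤ Y ω)
    (hanti : ∀ ω ∈ A, ∀ ω' ∈ A, (X ω - X ω') * (Y ω - Y ω') ≤ 0) {a b : ℝ}
    (hne : (A ∩ {ω | X ω ≤ a ∧ Y ω ≤ b}).Nonempty) :
    μ.real {ω | a < X ω} + μ.real {ω | b < Y ω} + μ.real (A ∩ {ω | X ω ≤ a ∧ Y ω ≤ b}) ≤
      μ.real A := by
  obtain ⟨ω₀, hω₀, ha, hb⟩ := hne
  have hXsub : {ω | a < X ω} ⊆ A := fun ω hω => by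
    by_contra h
    exact (lt_of_le_of_lt ha hω).not_ge (hXA ω₀ hω₀ ω h)
  have hYsub : {ω | b < Y ω} ⊆ A := fun ω hω => by
    by_contra h
    exact (lt_of_le_of_lt hb hω).not_ge (hYA ω₀ hω₀ ω h)
  have hdisj : Disjoint {ω | a < X ω} {ω | b < Y ω} := by
    refine disjoint_left.2 fun ω h₁ h₂ => (hanti ω (hXsub h₁) ω₀ hω₀).not_gt ?_
    exact mul_pos (sub_pos.2 (lt_of_le_of_lt ha h₁)) (sub_pos.2 (lt_of_le_of_lt hb h₂))
  have hdisj' : Disjoint ({ω | a < X ω} ∪ {ω | b < Y ω}) (A ∩ {ω | X ω ≤ a ∧ Y ω ≤ b}) := by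
    refine disjoint_left.2 ?_
    rintro ω (h | h) ⟨-, h₁, h₂⟩
    exacts [h.not_ge h₁, h.not_ge h₂]
  rw [← measureReal_union hdisj (measurableSet_lt measurable_const hY),
    ← measureReal_union hdisj' (hA.inter ((measurableSet_le hX measurable_const).inter
      (measurableSet_le hY measurable_const)))]
  exact measureReal_mono (union_subset (union_subset hXsub hYsub) inter_subset_left)

lemma one_sub_tails_le_measureReal_add_le {Ω : Type*} [MeasurableSpace Ω] {μ : Measure Ω}
    [IsProbabilityMeasure μ] (X Y : Ω → ℝ) {a b s : ℝ} (hab : a + b ≤ s) :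
    1 - μ.real {ω | a < X ω} - μ.real {ω | b < Y ω} ≤ μ.real {ω | X ω + Y ω ≤ s} := by
  have hcover : (univ : Set Ω) ⊆
      ({ω | X ω + Y ω ≤ s} ∪ {ω | a < X ω}) ∪ {ω | b < Y ω} := fun ω _ => by
    by_contra! h
    simp only [mem_union, mem_ofPred_eq, not_or, not_le, not_lt] at h
    linarith [h.1.1, h.1.2, h.2]
  have h₁ := measureReal_mono (μ := μ) hcover
  have h₂ := measureReal_union_le (μ := μ)
    ({ω | X ω + Y ω ≤ s} ∪ {ω | a < X ω}) {ω | b < Y ω}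
  have h₃ := measureReal_union_le (μ := μ) {ω | X ω + Y ω ≤ s} {ω | a < X ω}
  rw [probReal_univ] at h₁
  linarith

/-- Theorem 3.2(i) (Wang–Zitikis, "Weak comonotonicity"). If `X` and `Y` are weakly
comonotonic w.r.t. `𝒫^X_p` and weakly antimonotonic w.r.t. `𝒬^X_p`, then `(X, Y)`
maximizes the `VaR_p` aggregation. -/
theorem weaklyComonotonic_maximizes_VaR_aggregation {Ω : Type*} [MeasurableSpace Ω]
    (μ : Measure Ω) [IsProbabilityMeasure μ] (hμ : Atomless μ)
    (p : ℝ) (hp : p ∈ Set.Ioo (0 : ℝ) 1)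
    (X Y : Ω → ℝ) (hX : Measurable X) (hY : Measurable Y)
    (hXi : Integrable X μ) (hYi : Integrable Y μ)
    (hXc : ContinuouslyDistributed μ X) (hYc : ContinuouslyDistributed μ Y)
    (hWC : ∀ ω ∈ tailSet μ X p, ∀ ω' ∉ tailSet μ X p,
      WeaklyComonotonic X Y (Measure.dirac ω) (Measure.dirac ω'))
    (hWA : ∀ ω ∈ tailSet μ X p, ∀ ω' ∈ tailSet μ X p,
      WeaklyAntimonotonic X Y (Measure.dirac ω) (Measure.dirac ω')) :
    IsGreatest {v : ℝ | ∃ X' Y' : Ω → ℝ, Measurable X' ∧ Measurable Y' ∧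
        μ.map X' = μ.map X ∧ μ.map Y' = μ.map Y ∧
        v = VaR μ (fun ω => X' ω + Y' ω) p}
      (VaR μ (fun ω => X ω + Y ω) p) := by
  obtain ⟨hp0, hp1⟩ := hp
  refine ⟨⟨X, Y, hX, hY, rfl, rfl, rfl⟩, ?_⟩
  rintro _ ⟨X', Y', hX', hY', hmX, hmY, rfl⟩
  set A := tailSet μ X p with hAdef
  have hA : MeasurableSet A := measurableSet_tailSet hX
  have hXA : ∀ ω ∈ A, ∀ ω' ∉ A, X ω' < X ω := fun ω hω ω' hω' =>
    lt_of_le_of_lt (not_lt.1 hω') hω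
  have hYA : ∀ ω ∈ A, ∀ ω' ∉ A, Y ω' ≤ Y ω := fun ω hω ω' hω' =>
    sub_nonneg.1 (nonneg_of_mul_nonneg_right
      ((weaklyComonotonic_dirac_iff hX hY ω ω').1 (hWC ω hω ω' hω'))
      (sub_pos.2 (hXA ω hω ω' hω')))
  have hanti : ∀ ω ∈ A, ∀ ω' ∈ A, (X ω - X ω') * (Y ω - Y ω') ≤ 0 := fun ω hω ω' hω' =>
    (weaklyAntimonotonic_dirac_iff hX hY ω ω').1 (hWA ω hω ω' hω')
  have hAc_le : μ.real Aᶜ ≤ p := by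
    rw [hAdef, compl_tailSet]
    exact measureReal_le_VaR_le hX hXc hp0
  have hAc_ge : p ≤ μ.real Aᶜ := by
    rw [hAdef, compl_tailSet]
    exact le_measureReal_le_VaR hX hp1
  have hAadd := probReal_add_probReal_compl (μ := μ) hA
  refine le_VaR_of_forall (hX.add hY) hp1 fun s hs =>
    le_of_forall_gt_imp_ge_of_dense fun s' hs' => ?_
  simp only [Pi.add_apply] at hs
  have hpos : μ (A ∩ {ω | X ω + Y ω < s'}) ≠ 0 := by
    intro h0
    have hsub : {ω | X ω + Y ω ≤ s} ⊆ (A ∩ {ω | X ω + Y ω < s'}) ∪ Aᶜ := fun ω hω => by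
      by_cases h : ω ∈ A
      · exact Or.inl ⟨h, lt_of_le_of_lt hω hs'⟩
      · exact Or.inr h
    have h₁ := (measureReal_mono (μ := μ) hsub).trans (measureReal_union_le _ _)
    rw [measureReal_def μ (A ∩ _), h0, ENNReal.toReal_zero] at h₁
    linarith
  obtain ⟨a, b, hab, hE⟩ := exists_quadrant_measure_pos hpos
  have htails := measureReal_tails_add_quadrant_le (μ := μ) hX hY hA
    (fun ω hω ω' hω' => (hXA ω hω ω' hω').le) hYA hanti (nonempty_of_measure_ne_zero hE)
  have hEpos : 0 < μ.real (A ∩ {ω | X ω ≤ a ∧ Y ω ≤ b}) :=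
    ENNReal.toReal_pos hE (measure_ne_top _ _)
  have hT := one_sub_tails_le_measureReal_add_le (μ := μ) X' Y' hab.le
  rw [measureReal_gt_eq_of_map_eq hX hX' hmX, measureReal_gt_eq_of_map_eq hY hY' hmY] at hT
  exact VaR_le_of_lt_measureReal (hX'.add hY') hp0
    (by simp only [Pi.add_apply]; linarith)
end

section
/- Let X and Y be integrable random variables on a probability space (Ω, F, ℙ) such that XY is integrable under the relevant conditional measures. If X and Y are independent, then {ℙ_A × ℙ_B : A, B ∈ σ⁺(X)} ⊆ P_{X,Y}, and, by symmetry, {ℙ_A × ℙ_B : A, B ∈ σ⁺(Y)} ⊆ P_{X,Y}. -/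
open MeasureTheory Set

open ProbabilityTheory

/-- If `X` and `Y` are independent, conditioning on an event of `σ(X)` does not change the law
of `Y`. -/
lemma ProbabilityTheory.IndepFun.map_cond_left {Ω : Type*} [MeasurableSpace Ω]
    {μ : Measure Ω} [IsProbabilityMeasure μ] {X Y : Ω → ℝ} (hX : Measurable X) (hY : Measurable Y)
    (h : IndepFun X Y μ) {A : Set Ω}
    (hA : MeasurableSet[MeasurableSpace.comap X inferInstance] A) (hA0 : μ A ≠ 0) :
    (μ[|A]).map Y = μ.map Y := by
  obtain ⟨S, hS, rfl⟩ := hA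
  ext T hT
  rw [Measure.map_apply hY hT, Measure.map_apply hY hT, cond_apply (hX hS),
    h.measure_inter_preimage_eq_mul S T hS hT, ← mul_assoc,
    ENNReal.inv_mul_cancel hA0 (measure_ne_top _ _), one_mul]

/-- Independence of `X` and `Y` is preserved by conditioning on an event of `σ(X)`. -/
lemma ProbabilityTheory.IndepFun.cond_left {Ω : Type*} [MeasurableSpace Ω]
    {μ : Measure Ω} [IsProbabilityMeasure μ] {X Y : Ω → ℝ} (hX : Measurable X) (hY : Measurable Y)
    (h : IndepFun X Y μ) {A : Set Ω}
    (hA : MeasurableSet[MeasurableSpace.comap X inferInstance] A) (hA0 : μ A ≠ 0) :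
    IndepFun X Y (μ[|A]) := by
  have hlaw := h.map_cond_left hX hY hA hA0
  obtain ⟨S, hS, rfl⟩ := hA
  rw [indepFun_iff_measure_inter_preimage_eq_mul]
  intro U T hU hT
  rw [← Measure.map_apply hY hT, hlaw, Measure.map_apply hY hT, cond_apply (hX hS),
    cond_apply (hX hS), ← inter_assoc, ← preimage_inter,
    h.measure_inter_preimage_eq_mul _ T (hS.inter hU) hT, mul_assoc]

/-- Expansion of the double integral defining weak comonotonicity. -/
lemma integral_prod_sub_mul_sub {Ω : Type*} [MeasurableSpace Ω] {X Y : Ω → ℝ}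
    {π₁ π₂ : Measure Ω} [IsProbabilityMeasure π₁] [IsProbabilityMeasure π₂]
    (hX₁ : Integrable X π₁) (hX₂ : Integrable X π₂) (hY₁ : Integrable Y π₁)
    (hY₂ : Integrable Y π₂) (hXY₁ : Integrable (fun ω => X ω * Y ω) π₁)
    (hXY₂ : Integrable (fun ω => X ω * Y ω) π₂) :
    ∫ q : Ω × Ω, (X q.1 - X q.2) * (Y q.1 - Y q.2) ∂(π₁.prod π₂) =
      (∫ ω, X ω * Y ω ∂π₁) + (∫ ω, X ω * Y ω ∂π₂)
        - ((∫ ω, X ω ∂π₁) * ∫ ω, Y ω ∂π₂) - (∫ ω, Y ω ∂π₁) * ∫ ω, X ω ∂π₂ := by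
  have expand (q : Ω × Ω) : (X q.1 - X q.2) * (Y q.1 - Y q.2) =
      X q.1 * Y q.1 + X q.2 * Y q.2 - X q.1 * Y q.2 - Y q.1 * X q.2 := by ring
  have i₁ : Integrable (fun q : Ω × Ω => X q.1 * Y q.1) (π₁.prod π₂) := hXY₁.comp_fst π₂
  have i₂ : Integrable (fun q : Ω × Ω => X q.2 * Y q.2) (π₁.prod π₂) := hXY₂.comp_snd π₁
  have i₃ : Integrable (fun q : Ω × Ω => X q.1 * Y q.2) (π₁.prod π₂) := hX₁.mul_prod hY₂
  have i₄ : Integrable (fun q : Ω × Ω => Y q.1 * X q.2) (π₁.prod π₂) := hY₁.mul_prod hX₂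
  have i₁₂ : Integrable (fun q : Ω × Ω => X q.1 * Y q.1 + X q.2 * Y q.2) (π₁.prod π₂) :=
    i₁.add i₂
  have i₁₂₃ : Integrable (fun q : Ω × Ω => X q.1 * Y q.1 + X q.2 * Y q.2 - X q.1 * Y q.2)
      (π₁.prod π₂) := i₁₂.sub i₃
  simp_rw [expand]
  rw [integral_sub i₁₂₃ i₄, integral_sub i₁₂ i₃, integral_add i₁ i₂,
    integral_prod_mul, integral_prod_mul,
    integral_fun_fst (fun ω => X ω * Y ω), integral_fun_snd (fun ω => X ω * Y ω)]
  simp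

lemma WeaklyComonotonic.symm {Ω : Type*} [MeasurableSpace Ω] {X Y : Ω → ℝ} {π₁ π₂ : Measure Ω}
    (h : WeaklyComonotonic X Y π₁ π₂) : WeaklyComonotonic Y X π₁ π₂ := by
  simpa only [WeaklyComonotonic, mul_comm] using h

/-- Independent random variables are weakly comonotonic with respect to the product of two
conditional measures given events of `σ(X)`. -/
lemma ProbabilityTheory.IndepFun.weaklyComonotonic_cond_left {Ω : Type*} [MeasurableSpace Ω]
    {μ : Measure Ω} [IsProbabilityMeasure μ] {X Y : Ω → ℝ} (hX : Measurable X) (hY : Measurable Y)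
    (hXi : Integrable X μ) (hYi : Integrable Y μ) (h : IndepFun X Y μ) {A B : Set Ω}
    (hA : MeasurableSet[MeasurableSpace.comap X inferInstance] A)
    (hB : MeasurableSet[MeasurableSpace.comap X inferInstance] B)
    (hA0 : μ A ≠ 0) (hB0 : μ B ≠ 0) :
    WeaklyComonotonic X Y (μ[|A]) (μ[|B]) := by
  have integrable_cond {Z : Ω → ℝ} (hZ : Integrable Z μ) {C : Set Ω} (hC0 : μ C ≠ 0) :
      Integrable Z (μ[|C]) := hZ.restrict.smul_measure (ENNReal.inv_ne_top.2 hC0)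
  have integral_cond {C : Set Ω} (hC : MeasurableSet[MeasurableSpace.comap X inferInstance] C)
      (hC0 : μ C ≠ 0) : ∫ ω, Y ω ∂(μ[|C]) = ∫ ω, Y ω ∂μ := by
    have hlaw : IdentDistrib Y Y (μ[|C]) μ :=
      ⟨hY.aemeasurable, hY.aemeasurable, h.map_cond_left hX hY hC hC0⟩
    exact hlaw.integral_eq
  have := cond_isProbabilityMeasure hA0
  have := cond_isProbabilityMeasure hB0
  have indA := h.cond_left hX hY hA hA0
  have indB := h.cond_left hX hY hB hB0
  have hXA := integrable_cond hXi hA0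
  have hXB := integrable_cond hXi hB0
  have hYA := integrable_cond hYi hA0
  have hYB := integrable_cond hYi hB0
  rw [WeaklyComonotonic, integral_prod_sub_mul_sub hXA hXB hYA hYB
      (indA.integrable_mul hXA hYA) (indB.integrable_mul hXB hYB),
    indA.integral_fun_mul_eq_mul_integral hXA.aestronglyMeasurable hYA.aestronglyMeasurable,
    indB.integral_fun_mul_eq_mul_integral hXB.aestronglyMeasurable hYB.aestronglyMeasurable,
    integral_cond hA hA0, integral_cond hB hB0]
  exact le_of_eq (by ring)

/-- Proposition 4.4(i) (Wang–Zitikis, "Weak comonotonicity"). If the integrable random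
variables `X` and `Y` are independent, then `X` and `Y` are weakly comonotonic with
respect to every `ℙ_A × ℙ_B` with `A, B ∈ σ⁺(X)`, and, by symmetry, with respect to every
`ℙ_A × ℙ_B` with `A, B ∈ σ⁺(Y)`. -/
theorem indepFun_weaklyComonotonic_cond {Ω : Type*} [MeasurableSpace Ω]
    (μ : Measure Ω) [IsProbabilityMeasure μ]
    (X Y : Ω → ℝ) (hX : Measurable X) (hY : Measurable Y)
    (hXi : Integrable X μ) (hYi : Integrable Y μ)
    (hXYi : ∀ A : Set Ω, MeasurableSet A → 0 < μ A →
      Integrable (fun ω => X ω * Y ω) (μ[|A]))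
    (hIndep : IndepFun X Y μ) :
    (∀ A B : Set Ω, MeasurableSet[MeasurableSpace.comap X inferInstance] A →
      MeasurableSet[MeasurableSpace.comap X inferInstance] B →
      0 < μ A → 0 < μ B → WeaklyComonotonic X Y (μ[|A]) (μ[|B])) ∧
    (∀ A B : Set Ω, MeasurableSet[MeasurableSpace.comap Y inferInstance] A →
      MeasurableSet[MeasurableSpace.comap Y inferInstance] B →
      0 < μ A → 0 < μ B → WeaklyComonotonic X Y (μ[|A]) (μ[|B])) := by
  exact ⟨fun A B hA hB hA0 hB0 =>
      hIndep.weaklyComonotonic_cond_left hX hY hXi hYi hA hB hA0.ne' hB0.ne',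
    fun A B hA hB hA0 hB0 =>
      (hIndep.symm.weaklyComonotonic_cond_left hY hX hYi hXi hA hB hA0.ne' hB0.ne').symm⟩
end
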